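/- For |q|<1, the identity ∑_{n≥1} (-1)^n (q²;q²)_{n-1} q^{n²}/(-q;q)_{2n} = (1/4)·((q;q)_∞²/(-q;q)_∞² − 1) holds. -/

import Mathlib

open scoped BigOperators

/-- The finite q-Pochhammer symbol `(a;q)_n = ∏_{j=0}^{n-1} (1 - a q^j)`. -/
noncomputable def qPoch (a q : ℂ) (n : ℕ) : ℂ := ∏ j ∈ Finset.range n, (1 - a * q ^ j)

/-- The infinite q-Pochhammer symbol `(a;q)_∞ = ∏_{j=0}^{∞} (1 - a q^j)`. -/
noncomputable def qPochInf (a q : ℂ) : ℂ := ∏' j : ℕ, (1 - a * q ^ j)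

lemma qP_succ (a q : ℂ) (n : ℕ) : qPoch a q (n + 1) = qPoch a q n * (1 - a * q ^ n) := by
  simp [qPoch, Finset.prod_range_succ]

lemma qP_add (a q : ℂ) (k n : ℕ) :
    qPoch a q (k + n) = qPoch a q k * qPoch (a * q ^ k) q n := by
  simp [qPoch, Finset.prod_range_add, pow_add, mul_assoc]

lemma qP_double (a q : ℂ) (n : ℕ) :
    qPoch a q (2 * n) = qPoch a (q ^ 2) n * qPoch (a * q) (q ^ 2) n := by
  induction n with
  | zero => simp [qPoch]
  | succ n ih =>
    rw [show 2 * (n + 1) = 2 * n + 1 + 1 by ring, qP_succ, qP_succ, ih, qP_succ, qP_succ]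
    ring

lemma one_sub_ne {a : ℂ} (ha : ‖a‖ < 1) : 1 - a ≠ 0 := by
  intro h
  have : a = 1 := (sub_eq_zero.1 h).symm
  rw [this] at ha
  simp at ha

lemma one_add_ne {a : ℂ} (ha : ‖a‖ < 1) : 1 + a ≠ 0 := by
  have := one_sub_ne (a := -a) (by simpa using ha)
  simpa using this

lemma norm_mul_pow_lt {a q : ℂ} (ha : ‖a‖ < 1) (hq : ‖q‖ < 1) (n : ℕ) : ‖a * q ^ n‖ < 1 := by
  rw [norm_mul, norm_pow]
  have := pow_le_one₀ (norm_nonneg q) hq.le (n := n)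
  nlinarith [norm_nonneg a, pow_nonneg (norm_nonneg q) n]

lemma qP_ne {a q : ℂ} (ha : ‖a‖ < 1) (hq : ‖q‖ < 1) (n : ℕ) : qPoch a q n ≠ 0 := by
  rw [qPoch, Finset.prod_ne_zero_iff]
  intro j _
  exact one_sub_ne (norm_mul_pow_lt ha hq j)

lemma qP_summable (a : ℂ) {q : ℂ} (hq : ‖q‖ < 1) : Summable fun j : ℕ => ‖-(a * q ^ j)‖ := by
  simp only [norm_neg, norm_mul, norm_pow]
  exact (summable_geometric_of_lt_one (norm_nonneg q) hq).mul_left _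

lemma qP_tendsto (a : ℂ) {q : ℂ} (hq : ‖q‖ < 1) :
    Filter.Tendsto (qPoch a q) Filter.atTop (nhds (qPochInf a q)) := by
  have h := (multipliable_one_add_of_summable (qP_summable a hq)).hasProd.tendsto_prod_nat
  simp only [← sub_eq_add_neg] at h
  exact h

lemma qPInf_ne {a q : ℂ} (ha : ‖a‖ < 1) (hq : ‖q‖ < 1) : qPochInf a q ≠ 0 := by
  have h := tprod_one_add_ne_zero_of_summable (f := fun j : ℕ => -(a * q ^ j))
    (fun j => by
      have := one_sub_ne (norm_mul_pow_lt ha hq j)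
      simpa only [← sub_eq_add_neg] using this) (qP_summable a hq)
  simp only [← sub_eq_add_neg] at h
  exact h

lemma bdd_of_tendsto {f : ℕ → ℂ} {l : ℂ} (h : Filter.Tendsto f Filter.atTop (nhds l)) :
    ∃ C : ℝ, 0 < C ∧ ∀ n, ‖f n‖ ≤ C := by
  obtain ⟨C, hC⟩ := (Metric.isBounded_range_of_tendsto f h).exists_norm_le
  exact ⟨max C 1, by positivity, fun n => (hC _ ⟨n, rfl⟩).trans (le_max_left _ _)⟩

/-- summand of the first series -/
noncomputable def tt (Q x : ℂ) (n : ℕ) : ℂ :=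
  qPoch Q Q n * x ^ (n + 1) * Q ^ ((n + 1).choose 2) /
    (qPoch x Q (n + 1) * qPoch (-Q) Q (n + 1))

/-- telescoping certificate -/
noncomputable def uu (Q x : ℂ) (n : ℕ) : ℂ :=
  qPoch Q Q n * x ^ (n + 1) * Q ^ ((n + 1).choose 2) /
    (qPoch x Q (n + 1) * qPoch (-Q) Q n)

lemma tt_tele {Q x : ℂ} (hQ : ‖Q‖ < 1) (hx : ‖x‖ < 1) (n : ℕ) :
    tt Q x n + tt Q (x * Q) n = uu Q x n - uu Q x (n + 1) := by
  have hc : (n + 1 + 1).choose 2 = (n + 1) + (n + 1).choose 2 := by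
    rw [Nat.choose_succ_succ' (n + 1) 1]; simp
  have hs : (1 - x) * qPoch (x * Q) Q (n + 1) = qPoch x Q n * (1 - x * Q ^ n) * (1 - x * Q ^ (n + 1)) := by
    have := qP_add x Q 1 (n + 1)
    rw [show 1 + (n + 1) = n + 1 + 1 by ring, qP_succ, qP_succ] at this
    simp [qPoch] at this
    simp [qPoch, this]
  have h1 := one_sub_ne hx
  have hs' : qPoch (x * Q) Q (n + 1)
      = qPoch x Q n * (1 - x * Q ^ n) * (1 - x * Q ^ (n + 1)) / (1 - x) := by
    rw [← hs]; field_simp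
  have h2 := one_sub_ne (norm_mul_pow_lt hx hQ n)
  have h3 := one_sub_ne (norm_mul_pow_lt hx hQ (n + 1))
  have h4 := qP_ne hx hQ n
  have hQ' : ‖-Q‖ < 1 := by simpa using hQ
  have h5 := qP_ne hQ' hQ n
  have h6 := one_sub_ne (norm_mul_pow_lt hQ' hQ n)
  unfold tt uu
  rw [hs', hc, qP_succ x Q (n + 1), qP_succ x Q n, qP_succ (-Q) Q n, qP_succ Q Q n]
  simp only [pow_add, mul_pow, pow_one] at *
  generalize Q ^ n = v at *
  generalize Q ^ ((n + 1).choose 2) = w at *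
  generalize qPoch x Q n = A at *
  generalize qPoch (-Q) Q n = B at *
  have h6' : 1 + v * Q ≠ 0 := by
    intro h; apply h6; linear_combination h
  have h3' : 1 - x * v * Q ≠ 0 := by
    intro h; apply h3; linear_combination h
  rw [show 1 - -Q * v = 1 + v * Q by ring, show 1 - x * (v * Q) = 1 - x * v * Q by ring]
  field_simp
  ring

lemma tt_bound {Q x : ℂ} (hQ : ‖Q‖ < 1) (hx : ‖x‖ < 1) :
    ∃ C : ℝ, 0 < C ∧ ∀ k n, ‖tt Q (x * Q ^ k) n‖ ≤ C * ‖Q‖ ^ k * ‖x‖ ^ n := by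
  have hQ' : ‖-Q‖ < 1 := by simpa using hQ
  obtain ⟨C1, h1, b1⟩ := bdd_of_tendsto (qP_tendsto Q hQ)
  obtain ⟨C2, h2, b2⟩ := bdd_of_tendsto (qP_tendsto x hQ)
  obtain ⟨C3, h3, b3⟩ := bdd_of_tendsto ((qP_tendsto x hQ).inv₀ (qPInf_ne hx hQ))
  obtain ⟨C4, h4, b4⟩ := bdd_of_tendsto ((qP_tendsto (-Q) hQ).inv₀ (qPInf_ne hQ' hQ))
  refine ⟨C1 * C2 * C3 * C4, by positivity, fun k n => ?_⟩
  have e : tt Q (x * Q ^ k) n = qPoch Q Q n * qPoch x Q k * (qPoch x Q (k + (n + 1)))⁻¹ *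
      (qPoch (-Q) Q (n + 1))⁻¹ * ((Q ^ k) ^ (n + 1) * x ^ (n + 1) * Q ^ ((n + 1).choose 2)) := by
    rw [qP_add, tt]
    have := qP_ne hx hQ k
    have := qP_ne (norm_mul_pow_lt hx hQ k) hQ (n + 1)
    have := qP_ne hQ' hQ (n + 1)
    rw [mul_pow]
    field_simp
  rw [e]
  have e2 : ‖(Q ^ k) ^ (n + 1) * x ^ (n + 1) * Q ^ ((n + 1).choose 2)‖ ≤ ‖Q‖ ^ k * ‖x‖ ^ n := by
    simp only [norm_mul, norm_pow]
    have a1 : (‖Q‖ ^ k) ^ (n + 1) ≤ ‖Q‖ ^ k :=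
      pow_le_of_le_one (by positivity) (pow_le_one₀ (norm_nonneg _) hQ.le) (by simp)
    have a2 : ‖x‖ ^ (n + 1) ≤ ‖x‖ ^ n := pow_le_pow_of_le_one (norm_nonneg _) hx.le (by simp)
    have a3 : ‖Q‖ ^ ((n + 1).choose 2) ≤ 1 := pow_le_one₀ (norm_nonneg _) hQ.le
    calc _ ≤ ‖Q‖ ^ k * ‖x‖ ^ n * 1 := by gcongr
      _ = _ := by ring
  rw [norm_mul, norm_mul, norm_mul, norm_mul, mul_assoc (C1 * C2 * C3 * C4)]
  gcongr
  · exact b1 n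
  · exact b2 k
  · exact b3 _
  · exact b4 _

lemma uu_tendsto {Q x : ℂ} (hQ : ‖Q‖ < 1) (hx : ‖x‖ < 1) :
    Filter.Tendsto (uu Q x) Filter.atTop (nhds 0) := by
  obtain ⟨C, hC, b⟩ := tt_bound hQ hx
  have hQ' : ‖-Q‖ < 1 := by simpa using hQ
  apply squeeze_zero_norm (a := fun n => C * 2 * ‖x‖ ^ n)
  · intro n
    have e : uu Q x n = tt Q (x * Q ^ 0) n * (1 - -Q * Q ^ n) := by
      rw [uu, tt, qP_succ (-Q) Q n]
      have := qP_ne hx hQ (n + 1)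
      have := qP_ne hQ' hQ n
      have := one_sub_ne (norm_mul_pow_lt hQ' hQ n)
      simp only [pow_zero, mul_one]
      generalize 1 - -Q * Q ^ n = z at *
      field_simp
    rw [e, norm_mul]
    have h1 := b 0 n
    have h2 : ‖1 - -Q * Q ^ n‖ ≤ 2 := by
      have := norm_sub_le 1 (-Q * Q ^ n)
      have := norm_mul_pow_lt hQ' hQ n
      simp at *
      linarith
    calc _ ≤ (C * ‖Q‖ ^ 0 * ‖x‖ ^ n) * 2 := by gcongr
      _ = _ := by ring
  · simpa using (tendsto_pow_atTop_nhds_zero_of_lt_one (norm_nonneg x) hx).const_mul (C * 2)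

/-- difference of the two series -/
noncomputable def gg (Q x : ℂ) (n : ℕ) : ℂ := tt Q x n - x ^ (n + 1) / (1 + Q ^ (n + 1))

lemma norm_pow_succ_lt {Q : ℂ} (hQ : ‖Q‖ < 1) (n : ℕ) : ‖Q ^ (n + 1)‖ < 1 := by
  rw [pow_succ']; exact norm_mul_pow_lt hQ hQ n

lemma lam_le {Q : ℂ} (hQ : ‖Q‖ < 1) (n : ℕ) : ‖(1 + Q ^ (n + 1))⁻¹‖ ≤ (1 - ‖Q‖)⁻¹ := by
  rw [norm_inv]
  have h1 : ‖Q ^ (n + 1)‖ ≤ ‖Q‖ := by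
    rw [norm_pow]; exact pow_le_of_le_one (norm_nonneg _) hQ.le (by simp)
  have h2 := norm_sub_le (1 + Q ^ (n + 1)) (Q ^ (n + 1))
  simp only [add_sub_cancel_right, norm_one] at h2
  apply inv_anti₀ <;> linarith

lemma gg_bound {Q x : ℂ} (hQ : ‖Q‖ < 1) (hx : ‖x‖ < 1) :
    ∃ C : ℝ, 0 < C ∧ ∀ k n, ‖gg Q (x * Q ^ k) n‖ ≤ C * ‖Q‖ ^ k * ‖x‖ ^ n := by
  obtain ⟨C, hC, b⟩ := tt_bound hQ hx
  have h0 : 0 < 1 - ‖Q‖ := by linarith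
  refine ⟨C + (1 - ‖Q‖)⁻¹, by positivity, fun k n => ?_⟩
  have h2 : ‖(x * Q ^ k) ^ (n + 1) / (1 + Q ^ (n + 1))‖ ≤ (1 - ‖Q‖)⁻¹ * ‖Q‖ ^ k * ‖x‖ ^ n := by
    rw [div_eq_mul_inv, norm_mul]
    have a1 : (‖Q‖ ^ k) ^ (n + 1) ≤ ‖Q‖ ^ k :=
      pow_le_of_le_one (by positivity) (pow_le_one₀ (norm_nonneg _) hQ.le) (by simp)
    have a2 : ‖x‖ ^ (n + 1) ≤ ‖x‖ ^ n := pow_le_pow_of_le_one (norm_nonneg _) hx.le (by simp)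
    rw [mul_pow, norm_mul, norm_pow, norm_pow, norm_pow]
    calc _ ≤ (‖x‖ ^ n * ‖Q‖ ^ k) * (1 - ‖Q‖)⁻¹ := by
          gcongr
          exact lam_le hQ n
      _ = _ := by ring
  calc _ ≤ _ := norm_sub_le _ _
    _ ≤ C * ‖Q‖ ^ k * ‖x‖ ^ n + (1 - ‖Q‖)⁻¹ * ‖Q‖ ^ k * ‖x‖ ^ n := add_le_add (b k n) h2
    _ = _ := by ring

lemma gg_summable {Q x : ℂ} (hQ : ‖Q‖ < 1) (hx : ‖x‖ < 1) : Summable (gg Q x) := by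
  obtain ⟨C, hC, b⟩ := gg_bound hQ hx
  apply Summable.of_norm_bounded
    ((summable_geometric_of_lt_one (norm_nonneg x) hx).mul_left C)
  intro n
  simpa using b 0 n

lemma gg_step {Q x : ℂ} (hQ : ‖Q‖ < 1) (hx : ‖x‖ < 1) :
    ∑' n, gg Q (x * Q) n = - ∑' n, gg Q x n := by
  have hxQ : ‖x * Q‖ < 1 := by simpa using norm_mul_pow_lt hx hQ 1
  have hs := (gg_summable hQ hx).add (gg_summable hQ hxQ)
  have key : ∀ n, gg Q x n + gg Q (x * Q) n = (uu Q x n - uu Q x (n + 1)) - x ^ (n + 1) := by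
    intro n
    rw [← tt_tele hQ hx, gg, gg]
    have := one_add_ne (norm_pow_succ_lt hQ n)
    rw [mul_pow]
    field_simp
    ring
  have ht : Filter.Tendsto (fun N => ∑ n ∈ Finset.range N, (gg Q x n + gg Q (x * Q) n))
      Filter.atTop (nhds ((uu Q x 0 - 0) - x * (1 - x)⁻¹)) := by
    simp only [key, Finset.sum_sub_distrib, pow_succ']
    simp only [← Finset.sum_sub_distrib, Finset.sum_range_sub', ← Finset.mul_sum]
    refine (tendsto_const_nhds.sub (uu_tendsto hQ hx)).sub ?_
    exact (hasSum_geometric_of_norm_lt_one hx).tendsto_sum_nat.const_mul x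
  have h := tendsto_nhds_unique ht hs.hasSum.tendsto_sum_nat
  rw [(gg_summable hQ hx).tsum_add (gg_summable hQ hxQ)] at h
  have h0 : uu Q x 0 = x * (1 - x)⁻¹ := by simp [uu, qPoch, div_eq_mul_inv]
  rw [h0] at h
  linear_combination -h

lemma gg_zero {Q x : ℂ} (hQ : ‖Q‖ < 1) (hx : ‖x‖ < 1) : ∑' n, gg Q x n = 0 := by
  have h1 : ∀ k, ‖∑' n, gg Q (x * Q ^ k) n‖ = ‖∑' n, gg Q x n‖ := by
    intro k
    induction k with
    | zero => simp
    | succ k ih =>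
      rw [pow_succ, ← mul_assoc, gg_step hQ (norm_mul_pow_lt hx hQ k), norm_neg, ih]
  obtain ⟨C, hC, b⟩ := gg_bound hQ hx
  have h2 : ∀ k, ‖∑' n, gg Q x n‖ ≤ C * ‖Q‖ ^ k * (1 - ‖x‖)⁻¹ := by
    intro k
    rw [← h1 k]
    exact tsum_of_norm_bounded
      ((hasSum_geometric_of_lt_one (norm_nonneg x) hx).mul_left _) (b k)
  have h3 : Filter.Tendsto (fun k : ℕ => C * ‖Q‖ ^ k * (1 - ‖x‖)⁻¹) Filter.atTop (nhds 0) := by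
    simpa using ((tendsto_pow_atTop_nhds_zero_of_lt_one (norm_nonneg Q) hQ).const_mul C).mul_const
      (1 - ‖x‖)⁻¹
  have h4 := ge_of_tendsto' h3 h2
  exact norm_le_zero_iff.1 h4

lemma lam_summable {Q x : ℂ} (hQ : ‖Q‖ < 1) (hx : ‖x‖ < 1) :
    Summable fun n : ℕ => x ^ (n + 1) / (1 + Q ^ (n + 1)) := by
  apply Summable.of_norm_bounded
    ((summable_geometric_of_lt_one (norm_nonneg x) hx).mul_left (1 - ‖Q‖)⁻¹)
  intro n
  rw [div_eq_mul_inv, norm_mul, norm_pow, mul_comm]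
  have a2 : ‖x‖ ^ (n + 1) ≤ ‖x‖ ^ n := pow_le_pow_of_le_one (norm_nonneg _) hx.le (by simp)
  have := lam_le hQ n
  gcongr

lemma partA {Q x : ℂ} (hQ : ‖Q‖ < 1) (hx : ‖x‖ < 1) :
    ∑' n, tt Q x n = ∑' n : ℕ, x ^ (n + 1) / (1 + Q ^ (n + 1)) := by
  have h := gg_zero hQ hx
  have e : ∀ n, tt Q x n = gg Q x n + x ^ (n + 1) / (1 + Q ^ (n + 1)) := by
    intro n; simp [gg]
  simp only [e]
  rw [(gg_summable hQ hx).tsum_add (lam_summable hQ hx), h, zero_add]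

/-- quotient of Pochhammer symbols -/
noncomputable def AA (q : ℂ) (m : ℕ) : ℂ := qPoch (-q) (q ^ 2) m / qPoch (q ^ 2) (q ^ 2) m

lemma AA_succ (q : ℂ) (m : ℕ) :
    AA q (m + 1) = AA q m * ((1 + q * (q ^ m) ^ 2) / (1 - q ^ 2 * (q ^ m) ^ 2)) := by
  rw [AA, AA, qP_succ, qP_succ, mul_div_mul_comm]
  congr 2 <;> ring

/-- WZ certificate -/
noncomputable def GG (q : ℂ) (N n : ℕ) : ℂ :=
  4 * (1 + q ^ 3 * (q ^ N) ^ 4) / ((1 + q * (q ^ N) ^ 2) * (1 - q ^ 2 * (q ^ N) ^ 2)) * (-1) ^ n * q ^ n *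
    (q ^ (N - n)) ^ 2 * q * ((q ^ n) ^ 2 * q + 1) * AA q (N - n) * AA q (N + n + 1)

/-- summand -/
noncomputable def RR (q : ℂ) (N n : ℕ) : ℂ :=
  (-q) ^ (n + 1) / (1 + (q ^ 2) ^ (n + 1)) * (AA q (N - (n + 1)) * AA q (N + (n + 1)))

lemma ne1 {q : ℂ} (hq : ‖q‖ < 1) (m : ℕ) : 1 + q * (q ^ m) ^ 2 ≠ 0 := by
  have := one_add_ne (norm_pow_succ_lt hq (2 * m))
  intro h; apply this; rw [← h]; ring

lemma ne2 {q : ℂ} (hq : ‖q‖ < 1) (m : ℕ) : 1 - q ^ 2 * (q ^ m) ^ 2 ≠ 0 := by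
  have := one_sub_ne (norm_pow_succ_lt hq (2 * m + 1))
  intro h; apply this; rw [← h]; ring

lemma ne3 {q : ℂ} (hq : ‖q‖ < 1) (m : ℕ) : 1 + q ^ 2 * (q ^ m) ^ 2 ≠ 0 := by
  have := one_add_ne (norm_pow_succ_lt hq (2 * m + 1))
  intro h; apply this; rw [← h]; ring

lemma wz_step {q : ℂ} (hq : ‖q‖ < 1) (n e : ℕ) :
    (1 + q ^ 2 * (q ^ (n + 1 + e)) ^ 2) ^ 2 * (4 * RR q (n + 1 + e + 1) n)
      - (1 - q * (q ^ (n + 1 + e)) ^ 2) ^ 2 * (4 * RR q (n + 1 + e) n)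
      = GG q (n + 1 + e) (n + 1) - GG q (n + 1 + e) n := by
  have e1 : n + 1 + e + 1 - (n + 1) = e + 1 := by omega
  have e2 : n + 1 + e - (n + 1) = e := by omega
  have e3 : n + 1 + e - n = e + 1 := by omega
  have e4 : n + 1 + e + 1 + (n + 1) = 2 * n + e + 2 + 1 := by ring
  have e5 : n + 1 + e + (n + 1) = 2 * n + e + 2 := by ring
  have e6 : n + 1 + e + n + 1 = 2 * n + e + 2 := by ring
  have a1 := ne1 hq (n + 1 + e)
  have a2 := ne2 hq (n + 1 + e)
  have a3 := ne2 hq e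
  have a4 := ne2 hq (2 * n + e + 2)
  have a5 := ne3 hq n
  unfold RR GG
  rw [e1, e2, e3, e4, e5, e6, AA_succ q e, AA_succ q (2 * n + e + 2)]
  generalize AA q e = P at *
  generalize AA q (2 * n + e + 2) = S at *
  rw [neg_pow q, show (q ^ 2) ^ (n + 1) = q ^ 2 * (q ^ n) ^ 2 by ring]
  rw [show q ^ (2 * n + e + 2) = (q ^ n) ^ 2 * q ^ e * q ^ 2 by ring] at *
  rw [show q ^ (n + 1 + e) = q ^ n * q ^ e * q by ring] at *
  simp only [pow_succ q n, pow_succ q e, pow_succ (-1 : ℂ) n] at *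
  generalize q ^ n = u at *
  generalize q ^ e = v at *
  generalize (-1 : ℂ) ^ n = s at *
  rw [show 1 + q * (u * v * q) ^ 2 = 1 + q ^ 3 * u ^ 2 * v ^ 2 by ring] at *
  rw [show 1 - q ^ 2 * (u * v * q) ^ 2 = 1 - q ^ 4 * u ^ 2 * v ^ 2 by ring] at *
  rw [show 1 - q ^ 2 * (u ^ 2 * v * q ^ 2) ^ 2 = 1 - q ^ 6 * u ^ 4 * v ^ 2 by ring] at *
  field_simp
  ring

lemma wz_zero {q : ℂ} (hq : ‖q‖ < 1) (N : ℕ) :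
    (1 + q ^ 2 * (q ^ N) ^ 2) ^ 2 * AA q (N + 1) ^ 2
      - (1 - q * (q ^ N) ^ 2) ^ 2 * AA q N ^ 2 = GG q N 0 := by
  have a1 := ne1 hq N
  have a2 := ne2 hq N
  unfold GG
  simp only [Nat.sub_zero, Nat.add_zero, AA_succ, pow_zero]
  generalize AA q N = P at *
  generalize q ^ N = v at *
  field_simp
  ring

lemma wz_last {q : ℂ} (hq : ‖q‖ < 1) (N : ℕ) :
    (1 + q ^ 2 * (q ^ N) ^ 2) ^ 2 * (4 * RR q (N + 1) N) = - GG q N N := by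
  have a1 := ne1 hq N
  have a2 := ne2 hq N
  have a4 := ne2 hq (N + N + 1)
  have a5 := ne3 hq N
  unfold GG RR
  rw [show N + 1 + (N + 1) = N + N + 1 + 1 by ring, AA_succ q (N + N + 1), Nat.sub_self, Nat.sub_self]
  generalize AA q (N + N + 1) = P at *
  generalize AA q 0 = P' at *
  rw [neg_pow q, show (q ^ 2) ^ (N + 1) = q ^ 2 * (q ^ N) ^ 2 by ring]
  rw [show q ^ (N + N + 1) = (q ^ N) ^ 2 * q by ring] at *
  simp only [pow_succ q N, pow_succ (-1 : ℂ) N, pow_zero] at *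
  generalize q ^ N = v at *
  generalize (-1 : ℂ) ^ N = s at *
  have a4' : 1 - q ^ 4 * v ^ 4 ≠ 0 := by
    intro h; apply a4; rw [← h]; ring
  rw [show 1 - q ^ 2 * (v ^ 2 * q) ^ 2 = 1 - q ^ 4 * v ^ 4 by ring]
  field_simp
  ring

/-- product side -/
noncomputable def BB (q : ℂ) (N : ℕ) : ℂ := qPoch q (q ^ 2) N ^ 2 / qPoch (-q ^ 2) (q ^ 2) N ^ 2

lemma finite_id {q : ℂ} (hq : ‖q‖ < 1) (N : ℕ) :
    AA q N ^ 2 + 4 * ∑ n ∈ Finset.range N, RR q N n = BB q N := by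
  induction N with
  | zero => simp [AA, BB, qPoch]
  | succ N ih =>
    have h1 : ∑ n ∈ Finset.range N, ((1 + q ^ 2 * (q ^ N) ^ 2) ^ 2 * (4 * RR q (N + 1) n)
      - (1 - q * (q ^ N) ^ 2) ^ 2 * (4 * RR q N n)) = GG q N N - GG q N 0 := by
      rw [← Finset.sum_range_sub (GG q N)]
      apply Finset.sum_congr rfl
      intro n hn
      obtain ⟨e, rfl⟩ := Nat.exists_eq_add_of_lt (Finset.mem_range.1 hn)
      have := wz_step hq n e
      rw [show n + 1 + e = n + e + 1 by ring] at this
      exact this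
    rw [Finset.sum_sub_distrib, ← Finset.mul_sum, ← Finset.mul_sum, ← Finset.mul_sum,
      ← Finset.mul_sum] at h1
    have h2 := wz_zero hq N
    have h3 := wz_last hq N
    have a5 := ne3 hq N
    have hB : BB q (N + 1) = BB q N * ((1 - q * (q ^ N) ^ 2) ^ 2 / (1 + q ^ 2 * (q ^ N) ^ 2) ^ 2) := by
      rw [BB, BB, qP_succ, qP_succ, mul_pow, mul_pow, mul_div_mul_comm]
      congr 3 <;> ring
    rw [hB, ← ih, Finset.sum_range_succ]
    field_simp
    linear_combination h1 + h2 + h3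

lemma partB {q : ℂ} (hq : ‖q‖ < 1) :
    1 + 4 * ∑' n : ℕ, (-q) ^ (n + 1) / (1 + (q ^ 2) ^ (n + 1))
      = qPochInf q q ^ 2 / qPochInf (-q) q ^ 2 := by
  have hQ : ‖q ^ 2‖ < 1 := norm_pow_succ_lt hq 1
  have hQ' : ‖-q ^ 2‖ < 1 := by simpa using hQ
  have hq' : ‖-q‖ < 1 := by simpa using hq
  set a := qPochInf (-q) (q ^ 2) with ha
  set b := qPochInf (q ^ 2) (q ^ 2) with hb
  set c := qPochInf q (q ^ 2) with hc
  set d := qPochInf (-q ^ 2) (q ^ 2) with hd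
  have na : a ≠ 0 := qPInf_ne hq' hQ
  have nb : b ≠ 0 := qPInf_ne hQ hQ
  have nd : d ≠ 0 := qPInf_ne hQ' hQ
  have tA : Filter.Tendsto (AA q) Filter.atTop (nhds (a / b)) :=
    (qP_tendsto (-q) hQ).div (qP_tendsto (q ^ 2) hQ) nb
  have tB : Filter.Tendsto (BB q) Filter.atTop (nhds (c ^ 2 / d ^ 2)) :=
    ((qP_tendsto q hQ).pow 2).div ((qP_tendsto (-q ^ 2) hQ).pow 2) (pow_ne_zero 2 nd)
  have t2 : Filter.Tendsto (fun n : ℕ => 2 * n) Filter.atTop Filter.atTop :=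
    Filter.tendsto_id.const_mul_atTop' (by norm_num)
  have e1 : qPochInf q q = c * b := by
    refine tendsto_nhds_unique ((qP_tendsto q hq).comp t2) ?_
    have : (qPoch q q ∘ fun n => 2 * n) = fun n => qPoch q (q ^ 2) n * qPoch (q ^ 2) (q ^ 2) n := by
      funext n
      simp only [Function.comp, qP_double]
      congr 2; ring
    rw [this]
    exact (qP_tendsto q hQ).mul (qP_tendsto (q ^ 2) hQ)
  have e2 : qPochInf (-q) q = a * d := by
    refine tendsto_nhds_unique ((qP_tendsto (-q) hq).comp t2) ?_
    have : (qPoch (-q) q ∘ fun n => 2 * n)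
        = fun n => qPoch (-q) (q ^ 2) n * qPoch (-q ^ 2) (q ^ 2) n := by
      funext n
      simp only [Function.comp, qP_double]
      congr 2; ring
    rw [this]
    exact (qP_tendsto (-q) hQ).mul (qP_tendsto (-q ^ 2) hQ)
  obtain ⟨C, hC, bA⟩ := bdd_of_tendsto tA
  have tS : Filter.Tendsto (fun N => ∑' n, if n < N then RR q N n else 0) Filter.atTop
      (nhds (∑' n : ℕ, (-q) ^ (n + 1) / (1 + (q ^ 2) ^ (n + 1)) * (a / b * (a / b)))) := by
    refine tendsto_tsum_of_dominated_convergence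
      (bound := fun n : ℕ => ‖(-q) ^ (n + 1) / (1 + (q ^ 2) ^ (n + 1))‖ * (C * C)) ?_ ?_ ?_
    · exact (lam_summable hQ hq').norm.mul_right _
    · intro n
      have h : Filter.Tendsto (fun N => RR q N n) Filter.atTop
          (nhds ((-q) ^ (n + 1) / (1 + (q ^ 2) ^ (n + 1)) * (a / b * (a / b)))) := by
        unfold RR
        refine Filter.Tendsto.const_mul _ (Filter.Tendsto.mul ?_ ?_)
        · exact tA.comp (Filter.tendsto_sub_atTop_nat (n + 1))
        · exact tA.comp (Filter.tendsto_add_atTop_nat (n + 1))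
      refine h.congr' ?_
      filter_upwards [Filter.eventually_gt_atTop n] with N hN
      rw [if_pos hN]
    · refine Filter.Eventually.of_forall fun N n => ?_
      split_ifs
      · rw [RR, norm_mul, norm_mul (AA q _)]
        gcongr
        · exact bA _
        · exact bA _
      · rw [norm_zero]; positivity
  have eS : ∀ N, ∑' n, (if n < N then RR q N n else 0) = ∑ n ∈ Finset.range N, RR q N n := by
    intro N
    rw [tsum_eq_sum (s := Finset.range N)]
    · apply Finset.sum_congr rfl
      intro n hn
      rw [if_pos (Finset.mem_range.1 hn)]
    · intro n hn
      rw [if_neg (by simpa using hn)]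
  simp only [eS] at tS
  have tF := (tA.pow 2).add (tS.const_mul 4)
  simp only [finite_id hq] at tF
  have h := tendsto_nhds_unique tF tB
  rw [tsum_mul_right] at h
  rw [e1, e2]
  generalize ∑' n : ℕ, (-q) ^ (n + 1) / (1 + (q ^ 2) ^ (n + 1)) = Z at *
  have hfin : (1 + 4 * Z) * (a / b) ^ 2 = c ^ 2 / d ^ 2 := by rw [← h]; ring
  field_simp at hfin ⊢
  linear_combination hfin

/-- For |q|<1,
`∑_{n≥1} (-1)^n (q²;q²)_{n-1} q^{n²}/(-q;q)_{2n} = (1/4)((q;q)_∞²/(-q;q)_∞² - 1)`. -/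
theorem stmt_5 (q : ℂ) (hq : ‖q‖ < 1) :
    ∑' n : ℕ, (-1 : ℂ) ^ (n + 1) * qPoch (q ^ 2) (q ^ 2) n * q ^ ((n + 1) ^ 2) /
        qPoch (-q) q (2 * (n + 1))
      = (1 / 4) * (qPochInf q q ^ 2 / qPochInf (-q) q ^ 2 - 1) := by
  have hQ : ‖q ^ 2‖ < 1 := norm_pow_succ_lt hq 1
  have hq' : ‖-q‖ < 1 := by simpa using hq
  rw [← partB hq, ← partA hQ hq']
  have hc : ∀ n : ℕ, (n + 1) ^ 2 = (n + 1) + 2 * (n + 1).choose 2 := by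
    intro n
    induction n with
    | zero => simp
    | succ n ih =>
      rw [Nat.choose_succ_succ' (n + 1) 1]
      simp only [Nat.choose_one_right]
      nlinarith
  have : ∀ n : ℕ, (-1 : ℂ) ^ (n + 1) * qPoch (q ^ 2) (q ^ 2) n * q ^ ((n + 1) ^ 2) /
        qPoch (-q) q (2 * (n + 1)) = tt (q ^ 2) (-q) n := by
    intro n
    rw [tt, qP_double, hc, pow_add q, pow_mul q 2, neg_pow q, show -q * q = -q ^ 2 by ring]
    ring
  simp only [this]
  ring
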